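/- Let n ≥ 1 be a natural number and let α, β be integers with (α, β) ≠ (0, 0). Then Ω_0(⌊n/2⌋ | α, β | n) = Ψ(α, β, n) · ∏_{j=1}^{⌊n/2⌋}(n - j); in particular ∏_{j=1}^{⌊n/2⌋}(n - j) divides Ω_0(⌊n/2⌋ | α, β | n) in ℤ, and the quotient equals Ψ(α, β, n). -/

import Mathlib

/-- The `Ψ` sequence: `Ψ a b 0 = 2`, `Ψ a b 1 = 1`, and
`Ψ a b (m+2) = (2a-b)^(δ(m+1)) * Ψ a b (m+1) - a * Ψ a b m`. -/
def psiZ (a b : ℤ) : ℕ → ℤ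
  | 0 => 2
  | 1 => 1
  | m + 2 => (2 * a - b) ^ ((m + 1) % 2) * psiZ a b (m + 1) - a * psiZ a b m

/-- The Omega sequence `Ω_r(k | ζ, ξ | n)`: `Ω_r(0) = 1` and
`Ω_r(k+1) = (2ζ-ξ)(n-r-(k+1))·Ω_r(k) - 2ζ(n-2r-δ(n-1))·Ω_{r+1}(k)`. -/
def omegaZ (ζ ξ : ℤ) (n : ℕ) : ℕ → ℕ → ℤ
  | _, 0 => 1
  | r, k + 1 =>
    (2 * ζ - ξ) * ((n : ℤ) - r - (k + 1)) * omegaZ ζ ξ n r k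
      - 2 * ζ * ((n : ℤ) - 2 * r - ((n - 1) % 2 : ℕ)) * omegaZ ζ ξ n (r + 1) k

open Finset

/-- The absolute values of the coefficients of the Lucas polynomials: `lucasCoeff n i` is
`n / (n - i) * (n - i).choose i` for `2 * i ≤ n`, `1 ≤ n`. -/
def lucasCoeff : ℕ → ℕ → ℕ
  | 0, 0 => 2
  | 0, _ + 1 => 0
  | 1, 0 => 1
  | 1, _ + 1 => 0
  | n + 2, 0 => lucasCoeff (n + 1) 0
  | n + 2, i + 1 => lucasCoeff (n + 1) (i + 1) + lucasCoeff n i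

theorem lucasCoeff_add_two_succ (n i : ℕ) :
    lucasCoeff (n + 2) (i + 1) = lucasCoeff (n + 1) (i + 1) + lucasCoeff n i := by
  rw [lucasCoeff]

theorem lucasCoeff_succ_zero (n : ℕ) : lucasCoeff (n + 1) 0 = 1 := by
  induction n with
  | zero => rw [lucasCoeff]
  | succ n ih => rw [lucasCoeff, ih]

theorem lucasCoeff_eq_zero : ∀ {n i : ℕ}, n < 2 * i → lucasCoeff n i = 0
  | _, 0, h => by omega
  | 0, _ + 1, _ => by rw [lucasCoeff]
  | 1, _ + 1, _ => by rw [lucasCoeff]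
  | n + 2, i + 1, h => by
    rw [lucasCoeff, lucasCoeff_eq_zero (by omega), lucasCoeff_eq_zero (by omega)]

theorem lucasCoeff_two_mul_self (i : ℕ) : lucasCoeff (2 * i) i = 2 := by
  induction i with
  | zero => rw [lucasCoeff]
  | succ i ih =>
    rw [show 2 * (i + 1) = 2 * i + 2 by ring, lucasCoeff, ih, lucasCoeff_eq_zero (by omega)]

theorem lucasCoeff_mul_factorial (p : ℕ) : ∀ i q : ℕ, i + q = p + 1 →
    lucasCoeff (2 * i + q) i * (i.factorial * q.factorial) = (2 * i + q) * p.factorial := by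
  induction p with
  | zero =>
    intro i q h
    obtain ⟨rfl, rfl⟩ | ⟨rfl, rfl⟩ : (i = 0 ∧ q = 1) ∨ (i = 1 ∧ q = 0) := by omega
    all_goals simp [lucasCoeff]
  | succ p ih =>
    rintro (_ | i) (_ | q) h
    · omega
    · obtain rfl : q = p + 1 := by omega
      simp [lucasCoeff_succ_zero, Nat.factorial_succ]
    · obtain rfl : i = p + 1 := by omega
      rw [add_zero, lucasCoeff_two_mul_self]
      simp only [Nat.factorial_succ, Nat.factorial_zero]
      ring
    · have h₁ := ih (i + 1) q (by omega)
      have h₂ := ih i (q + 1) (by omega)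
      obtain rfl : p = i + q := by omega
      rw [show 2 * (i + 1) + (q + 1) = 2 * i + (q + 1) + 2 by ring, lucasCoeff_add_two_succ,
        show 2 * i + (q + 1) + 1 = 2 * (i + 1) + q by ring]
      simp only [Nat.factorial_succ] at h₁ h₂ ⊢
      linear_combination (q + 1) * h₁ + (i + 1) * h₂

theorem psiZ_closed_form_aux (a b : ℤ) (m : ℕ) :
    psiZ a b (2 * m) =
      ∑ i ∈ range (m + 1), (lucasCoeff (2 * m) i : ℤ) * (-a) ^ i * (2 * a - b) ^ (m - i) ∧
    psiZ a b (2 * m + 1) =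
      ∑ i ∈ range (m + 1), (lucasCoeff (2 * m + 1) i : ℤ) * (-a) ^ i * (2 * a - b) ^ (m - i) := by
  induction m with
  | zero => simp [psiZ, lucasCoeff]
  | succ m ih =>
    obtain ⟨hE, hO⟩ := ih
    have hE' : psiZ a b (2 * (m + 1)) = ∑ i ∈ range (m + 1 + 1),
        (lucasCoeff (2 * (m + 1)) i : ℤ) * (-a) ^ i * (2 * a - b) ^ (m + 1 - i) := by
      have hc : (2 * a - b) * psiZ a b (2 * m + 1) = ∑ i ∈ range (m + 1 + 1),
          (lucasCoeff (2 * m + 1) i : ℤ) * (-a) ^ i * (2 * a - b) ^ (m + 1 - i) := by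
        rw [sum_range_succ, lucasCoeff_eq_zero (n := 2 * m + 1) (by omega), hO, mul_sum]
        simp only [Nat.cast_zero, zero_mul, add_zero]
        refine sum_congr rfl fun i hi => ?_
        rw [Nat.sub_add_comm (Nat.lt_succ_iff.mp (mem_range.mp hi)), pow_succ]
        ring
      rw [show 2 * (m + 1) = 2 * m + 2 by ring, psiZ, show (2 * m + 1) % 2 = 1 by omega, pow_one,
        hc, hE, mul_sum, sum_range_succ', sum_range_succ' _ (m + 1), lucasCoeff_succ_zero,
        lucasCoeff_succ_zero, add_sub_right_comm, ← sum_sub_distrib]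
      congr 1
      refine sum_congr rfl fun i _ => ?_
      rw [lucasCoeff_add_two_succ, Nat.add_sub_add_right]
      push_cast
      ring
    refine ⟨hE', ?_⟩
    rw [show 2 * (m + 1) + 1 = 2 * m + 1 + 2 by ring, psiZ,
      show (2 * m + 1 + 1) % 2 = 0 by omega, pow_zero, one_mul,
      show 2 * m + 1 + 1 = 2 * (m + 1) by ring, hE', hO, mul_sum, sum_range_succ',
      sum_range_succ' _ (m + 1), lucasCoeff_succ_zero, show 2 * (m + 1) = 2 * m + 1 + 1 by ring,
      lucasCoeff_succ_zero, add_sub_right_comm, ← sum_sub_distrib]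
    congr 1
    refine sum_congr rfl fun i _ => ?_
    rw [lucasCoeff_add_two_succ (2 * m + 1), Nat.add_sub_add_right]
    push_cast
    ring

theorem psiZ_closed_form (a b : ℤ) (n : ℕ) :
    psiZ a b n = ∑ i ∈ range (n / 2 + 1),
      (lucasCoeff n i : ℤ) * (-a) ^ i * (2 * a - b) ^ (n / 2 - i) := by
  obtain ⟨m, rfl | rfl⟩ := n.even_or_odd'
  · simpa using (psiZ_closed_form_aux a b m).1
  · simpa [show (2 * m + 1) / 2 = m by omega] using (psiZ_closed_form_aux a b m).2

theorem omegaZ_closed_form (ζ ξ : ℤ) (n k : ℕ) : ∀ r : ℕ,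
    omegaZ ζ ξ n r k = ∑ i ∈ range (k + 1), (k.choose i : ℤ) *
      ((-(2 * ζ)) ^ i * (2 * ζ - ξ) ^ (k - i) *
        (∏ l ∈ range i, ((n : ℤ) - 2 * r - 2 * l - ((n - 1) % 2 : ℕ))) *
        ∏ j ∈ Ico i k, ((n : ℤ) - r - (j + 1))) := by
  induction k with
  | zero => simp [omegaZ]
  | succ k ih =>
    intro r
    set X : ℕ → ℤ := fun i => (-(2 * ζ)) ^ i * (2 * ζ - ξ) ^ (k + 1 - i) *
        (∏ l ∈ range i, ((n : ℤ) - 2 * r - 2 * l - ((n - 1) % 2 : ℕ))) *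
        ∏ j ∈ Ico i (k + 1), ((n : ℤ) - r - (j + 1)) with hX
    have h₁ : (2 * ζ - ξ) * ((n : ℤ) - r - (k + 1)) * omegaZ ζ ξ n r k =
        ∑ i ∈ range (k + 1), (k.choose i : ℤ) * X i := by
      rw [ih r, mul_sum]
      refine sum_congr rfl fun i hi => ?_
      have hik : i ≤ k := Nat.lt_succ_iff.mp (mem_range.mp hi)
      simp only [hX]
      rw [Nat.sub_add_comm hik, pow_succ, prod_Ico_succ_top hik]
      ring
    have h₂ : 2 * ζ * ((n : ℤ) - 2 * r - ((n - 1) % 2 : ℕ)) * omegaZ ζ ξ n (r + 1) k =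
        -∑ i ∈ range (k + 1), (k.choose i : ℤ) * X (i + 1) := by
      rw [ih (r + 1), mul_sum, ← sum_neg_distrib]
      refine sum_congr rfl fun i _ => ?_
      have hA : ∏ l ∈ range (i + 1), ((n : ℤ) - 2 * r - 2 * l - ((n - 1) % 2 : ℕ)) =
          (∏ l ∈ range i, ((n : ℤ) - 2 * (r + 1 : ℕ) - 2 * l - ((n - 1) % 2 : ℕ))) *
            ((n : ℤ) - 2 * r - ((n - 1) % 2 : ℕ)) := by
        rw [prod_range_succ']
        congr 1
        · refine prod_congr rfl fun l _ => ?_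
          push_cast
          ring
        · push_cast
          ring
      have hB : ∏ j ∈ Ico (i + 1) (k + 1), ((n : ℤ) - r - (j + 1)) =
          ∏ j ∈ Ico i k, ((n : ℤ) - (r + 1 : ℕ) - (j + 1)) := by
        rw [← prod_Ico_add' (fun j : ℕ => (n : ℤ) - r - (j + 1)) i k 1]
        refine prod_congr rfl fun j _ => ?_
        push_cast
        ring
      simp only [hX]
      rw [hA, hB, Nat.add_sub_add_right, pow_succ]
      ring
    have h₃ : ∑ i ∈ range (k + 1), (k.choose i : ℤ) * X i =
        ∑ i ∈ range (k + 1), (k.choose (i + 1) : ℤ) * X (i + 1) + X 0 := by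
      have h := sum_range_succ (fun i => (k.choose i : ℤ) * X i) (k + 1)
      rw [sum_range_succ'] at h
      simpa using h.symm
    rw [omegaZ, h₁, h₂, h₃, sum_range_succ' _ (k + 1), sub_neg_eq_add, add_right_comm,
      ← sum_add_distrib]
    congr 1
    · refine sum_congr rfl fun i _ => ?_
      change _ = _ * X (i + 1)
      rw [Nat.choose_succ_succ']
      push_cast
      ring
    · simp [hX]

theorem two_pow_mul_prod_mul_factorial (t e d : ℕ) (hed : e + d = 1) (i : ℕ) :
    ((i + t).factorial : ℤ) * 2 ^ i *
      (∏ l ∈ range i, ((2 * (i + t) + e : ℕ) - 2 * (l : ℤ) - d)) * (2 * t + e).factorial =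
      (2 * (i + t) + e).factorial * t.factorial := by
  induction i with
  | zero => simp [mul_comm]
  | succ i ih =>
    have hA : ∏ l ∈ range (i + 1), (((2 * (i + 1 + t) + e : ℕ) : ℤ) - 2 * (l : ℤ) - d) =
        (∏ l ∈ range i, (((2 * (i + t) + e : ℕ) : ℤ) - 2 * (l : ℤ) - d)) *
          (2 * (i + 1 + t) + e - d) := by
      rw [prod_range_succ']
      refine congrArg₂ _ (prod_congr rfl fun l _ => ?_) ?_ <;> push_cast <;> ring
    rw [hA, show 2 * (i + 1 + t) + e = 2 * (i + t) + e + 1 + 1 by ring,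
      show i + 1 + t = i + t + 1 by ring]
    simp only [Nat.factorial_succ]
    obtain ⟨rfl, rfl⟩ | ⟨rfl, rfl⟩ : (e = 0 ∧ d = 1) ∨ (e = 1 ∧ d = 0) := by omega
    · push_cast at ih ⊢
      linear_combination (2 * (i + t + 1) * (2 * (i + t) + 1) : ℤ) * ih
    · push_cast at ih ⊢
      linear_combination (2 * (i + t + 1) * (2 * (i + t) + 3) : ℤ) * ih

theorem prod_range_sub_mul_factorial (p i : ℕ) :
    (∏ l ∈ range i, ((p + i : ℕ) - (l : ℤ))) * p.factorial = (p + i).factorial := by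
  rw [← Nat.factorial_mul_descFactorial (Nat.le_add_left i p), Nat.descFactorial_eq_prod_range,
    Nat.add_sub_cancel, Nat.cast_mul, Nat.cast_prod, mul_comm]
  congr 1
  refine prod_congr rfl fun l hl => ?_
  rw [Nat.cast_sub (by have := mem_range.mp hl; omega)]

theorem choose_mul_two_pow_mul_prod {n i : ℕ} (hn : 1 ≤ n) (hi : i ≤ n / 2) :
    ((n / 2).choose i : ℤ) * 2 ^ i *
      ∏ l ∈ range i, ((n : ℤ) - 2 * l - ((n - 1) % 2 : ℕ)) =
      lucasCoeff n i * ∏ l ∈ range i, ((n : ℤ) - (l + 1)) := by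
  obtain ⟨t, ht⟩ := Nat.exists_eq_add_of_le hi
  obtain ⟨e, he⟩ : ∃ e, e = n % 2 := ⟨_, rfl⟩
  obtain ⟨d, hd⟩ : ∃ d, d = (n - 1) % 2 := ⟨_, rfl⟩
  have hn' : n = 2 * (i + t) + e := by omega
  obtain ⟨p, hp⟩ : ∃ p, i + (2 * t + e) = p + 1 := ⟨i + (2 * t + e) - 1, by omega⟩
  have h₁ := two_pow_mul_prod_mul_factorial t e d (by omega) i
  have h₂ := congrArg (Nat.cast : ℕ → ℤ) (lucasCoeff_mul_factorial p i (2 * t + e) hp)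
  have h₃ := prod_range_sub_mul_factorial p i
  have h₄ : ((i + t).choose i : ℤ) * i.factorial * t.factorial = (i + t).factorial := by
    rw [Nat.choose_symm_add]
    exact_mod_cast Nat.add_choose_mul_factorial_mul_factorial i t
  have h₅ : ∏ l ∈ range i, ((n : ℤ) - (l + 1)) = ∏ l ∈ range i, ((p + i : ℕ) - (l : ℤ)) := by
    refine prod_congr rfl fun l _ => ?_
    rw [show n = p + i + 1 by omega]
    push_cast
    ring
  have h₆ : (n.factorial : ℤ) = n * (p + i).factorial := by
    rw [show n = p + i + 1 by omega, Nat.factorial_succ, Nat.cast_mul]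
  rw [← hn'] at h₁
  rw [show 2 * i + (2 * t + e) = n by omega] at h₂
  rw [ht, ← hd, h₅]
  push_cast only [Nat.cast_mul] at h₂
  have hne : (i.factorial * t.factorial * (2 * t + e).factorial : ℤ) ≠ 0 := by
    exact_mod_cast (by positivity)
  refine mul_right_cancel₀ hne ?_
  rw [← h₄, h₆, ← h₃] at h₁
  linear_combination h₁ - t.factorial * (∏ l ∈ range i, ((p + i : ℕ) - (l : ℤ))) * h₂

theorem omegaZ_zero_eq_psiZ_mul_prod {n : ℕ} (hn : 1 ≤ n) (a b : ℤ) :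
    omegaZ a b n 0 (n / 2) = psiZ a b n * ∏ j ∈ Icc 1 (n / 2), ((n : ℤ) - j) := by
  have hprod : ∏ j ∈ Icc 1 (n / 2), ((n : ℤ) - j) =
      ∏ j ∈ range (n / 2), ((n : ℤ) - (j + 1)) := by
    rw [range_eq_Ico, ← Ico_add_one_right_eq_Icc,
      ← prod_Ico_add' (fun j : ℕ => (n : ℤ) - j) 0 (n / 2) 1]
    simp
  rw [hprod, omegaZ_closed_form, psiZ_closed_form, sum_mul]
  refine sum_congr rfl fun i hi => ?_
  have hi' : i ≤ n / 2 := Nat.lt_succ_iff.mp (mem_range.mp hi)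
  have h := choose_mul_two_pow_mul_prod hn hi'
  rw [← prod_range_mul_prod_Ico _ hi', show -(2 * a) = 2 * -a by ring, mul_pow]
  simp only [Nat.cast_zero, mul_zero, sub_zero]
  linear_combination (-a) ^ i * (2 * a - b) ^ (n / 2 - i) *
    (∏ j ∈ Ico i (n / 2), ((n : ℤ) - (j + 1))) * h

theorem omega_first_fundamental
    (n : ℕ) (hn : 1 ≤ n) (α β : ℤ) (hab : ¬(α = 0 ∧ β = 0)) :
    omegaZ α β n 0 (n / 2) = psiZ α β n * ∏ j ∈ Finset.Icc 1 (n / 2), ((n : ℤ) - j) ∧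
    (∏ j ∈ Finset.Icc 1 (n / 2), ((n : ℤ) - j)) ∣ omegaZ α β n 0 (n / 2) ∧
    omegaZ α β n 0 (n / 2) / (∏ j ∈ Finset.Icc 1 (n / 2), ((n : ℤ) - j)) = psiZ α β n := by
  have h := omegaZ_zero_eq_psiZ_mul_prod hn α β
  have hne : ∏ j ∈ Finset.Icc 1 (n / 2), ((n : ℤ) - j) ≠ 0 := by
    refine prod_ne_zero_iff.mpr fun j hj => ?_
    have := mem_Icc.mp hj
    omega
  exact ⟨h, h ▸ dvd_mul_left _ _, by rw [h, Int.mul_ediv_cancel _ hne]⟩
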